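/- Let α be a real number and suppose that the complex number β = e^{iα} is algebraic over ℚ. Then α/π is either rational or transcendental over ℚ. -/

import Mathlib

open NumberField Module

theorem exists_eq_prod_sub_mul_of_forall_eq_zero {f : ℂ → ℂ} (hf : Differentiable ℂ f)
    (Z : Finset ℂ) (hZ : ∀ ζ ∈ Z, f ζ = 0) :
    ∃ g : ℂ → ℂ, Differentiable ℂ g ∧ ∀ z, f z = (∏ ζ ∈ Z, (z - ζ)) * g z := by
  classical
  induction Z using Finset.induction_on with
  | empty => exact ⟨f, hf, by simp⟩
  | insert a Z ha ih =>
    obtain ⟨g, hg, hfg⟩ := ih fun ζ hζ ↦ hZ ζ (Finset.mem_insert_of_mem hζ)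
    have hga : g a = 0 := by
      have h := hfg a
      rw [hZ a (Finset.mem_insert_self a Z)] at h
      refine (mul_eq_zero.1 h.symm).resolve_left (Finset.prod_ne_zero_iff.2 fun ζ hζ ↦ ?_)
      exact sub_ne_zero.2 fun h ↦ ha (h ▸ hζ)
    refine ⟨dslope g a, fun z ↦ ?_, fun z ↦ ?_⟩
    · exact (((Complex.differentiableOn_dslope (s := Set.univ) Filter.univ_mem).2
        hg.differentiableOn) z trivial).differentiableAt Filter.univ_mem
    · have h := sub_smul_dslope g a z
      rw [hga, sub_zero, smul_eq_mul] at h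
      rw [hfg, Finset.prod_insert ha, ← h]
      ring

/-- A Schwarz lemma for an entire function with prescribed zeros. -/
theorem norm_le_div_two_pow_card_of_forall_eq_zero {f : ℂ → ℂ} (hf : Differentiable ℂ f)
    {Z : Finset ℂ} (hZ : ∀ ζ ∈ Z, f ζ = 0) {r M : ℝ} (hr : 0 < r) (hZr : ∀ ζ ∈ Z, ‖ζ‖ ≤ r)
    (hM : ∀ z, ‖z‖ ≤ 5 * r → ‖f z‖ ≤ M) {z : ℂ} (hz : ‖z‖ ≤ r) :
    ‖f z‖ ≤ M / 2 ^ Z.card := by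
  obtain ⟨g, hg, hfg⟩ := exists_eq_prod_sub_mul_of_forall_eq_zero hf Z hZ
  have hgz : ‖g z‖ ≤ M / (4 * r) ^ Z.card := by
    refine Complex.norm_le_of_forall_mem_frontier_norm_le (U := Metric.ball 0 (5 * r))
      Metric.isBounded_ball hg.diffContOnCl (fun w hw ↦ ?_)
      (subset_closure (by simpa using by linarith))
    rw [frontier_ball _ (by positivity), mem_sphere_zero_iff_norm] at hw
    rw [le_div_iff₀ (by positivity), mul_comm]
    refine le_trans ?_ (hM w hw.le)
    rw [hfg, norm_mul, norm_prod]
    gcongr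
    rw [← Finset.prod_const]
    refine Finset.prod_le_prod (fun _ _ ↦ by positivity) fun ζ hζ ↦ ?_
    have := norm_sub_norm_le w ζ
    have := hZr ζ hζ
    linarith
  have hprod : ‖∏ ζ ∈ Z, (z - ζ)‖ ≤ (2 * r) ^ Z.card := by
    rw [norm_prod, ← Finset.prod_const]
    refine Finset.prod_le_prod (fun _ _ ↦ by positivity) fun ζ hζ ↦ ?_
    have := norm_sub_le z ζ
    have := hZr ζ hζ
    linarith
  calc ‖f z‖ = ‖∏ ζ ∈ Z, (z - ζ)‖ * ‖g z‖ := by rw [hfg, norm_mul]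
    _ ≤ (2 * r) ^ Z.card * (M / (4 * r) ^ Z.card) := by gcongr
    _ = M / 2 ^ Z.card := by
      rw [show 4 * r = 2 * (2 * r) by ring, mul_pow 2 (2 * r)]
      field_simp

theorem NumberField.one_le_norm_mul_house_pow {K : Type*} [Field K] [NumberField K]
    (σ : K →+* ℂ) {x : 𝓞 K} (hx : x ≠ 0) :
    1 ≤ ‖σ x‖ * house (x : K) ^ (finrank ℚ K - 1) := by
  refine le_trans ?_ (norm_norm_le_norm_mul_house_pow (x : K) σ)
  rw [← Algebra.coe_norm_int, Int.norm_cast_rat, Int.norm_eq_abs]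
  have h : (1 : ℤ) ≤ |Algebra.norm ℤ x| := Int.one_le_abs (Algebra.norm_ne_zero_iff.2 hx)
  exact_mod_cast h

/-- A polynomial in `z` and `γ ^ m` vanishing at all `z = n + m * θ` is zero. -/
theorem eq_zero_of_forall_sum_mul_pow_eq_zero {F : Type*} [Field F] [CharZero F] {θ γ : F}
    (hγ : Function.Injective fun m : ℕ ↦ γ ^ m) {D E : ℕ} {c : Fin D × Fin E → F}
    (h : ∀ n m : ℕ, ∑ j, c j * ((n + m * θ) ^ (j.1 : ℕ) * γ ^ (m * j.2)) = 0) : c = 0 := by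
  have key : ∀ (N : ℕ) (b : Fin N → F) (x : ℕ → F), Function.Injective x →
      (∀ n, ∑ i, b i * x n ^ (i : ℕ) = 0) → ∀ i, b i = 0 := by
    intro N b x hx hb i
    have hp : (∑ i, Polynomial.C (b i) * Polynomial.X ^ (i : ℕ) : Polynomial F) = 0 := by
      refine Polynomial.eq_zero_of_infinite_isRoot _
        ((Set.infinite_range_of_injective hx).mono ?_)
      rintro _ ⟨n, rfl⟩
      simpa [Polynomial.IsRoot, Polynomial.eval_finsetSum] using hb n
    simpa [Polynomial.finsetSum_coeff, Polynomial.coeff_X_pow, Fin.val_inj]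
      using congrArg (Polynomial.coeff · (i : ℕ)) hp
  funext ⟨k, l⟩
  refine key E (fun l ↦ c (k, l)) _ hγ (fun m ↦ ?_) l
  refine key D (fun k ↦ ∑ l, c (k, l) * (γ ^ m) ^ (l : ℕ)) (fun n ↦ n + m * θ)
    (fun n n' h ↦ by simpa using h) (fun n ↦ ?_) k
  rw [← h n m, Fintype.sum_prod_type]
  refine Finset.sum_congr rfl fun k _ ↦ ?_
  rw [Finset.sum_mul]
  refine Finset.sum_congr rfl fun l _ ↦ ?_
  rw [pow_mul]; ring

/-- Siegel's lemma over a number field, with twice as many unknowns as equations. -/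
theorem NumberField.exists_siegel_const (K : Type*) [Field K] [NumberField K] :
    ∃ C : ℝ, ∀ {α β : Type} [Fintype α] [Fintype β]
    (a : Matrix α β (𝓞 K)) (A : ℝ), a ≠ 0 → 0 < Fintype.card α →
    Fintype.card β = 2 * Fintype.card α → (∀ i j, house (a i j : K) ≤ A) →
    ∃ ξ : β → 𝓞 K, ξ ≠ 0 ∧ a.mulVec ξ = 0 ∧
      ∀ j, house (ξ j : K) ≤ C * (C * Fintype.card β * A) := by
  classical
  apply Exists.intro
  intro α β _ _ a A ha hα hβ hA
  obtain ⟨ξ, h₁, h₂, h₃⟩ := house.exists_ne_zero_int_vec_house_le K a ha hα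
    (show Fintype.card α < Fintype.card β by omega) rfl hA rfl
  refine ⟨ξ, h₁, h₂, fun j ↦ ?_⟩
  have h := h₃ j
  rw [show (Fintype.card α : ℝ) / (Fintype.card β - Fintype.card α) = 1 by
    rw [hβ]; push_cast; field_simp; ring, Real.rpow_one] at h
  exact h

section
variable {K : Type*} [Field K]

/-- The value at `n + m * θ` of `z ↦ z ^ k * exp (2 * π * I * l * z)`, where
`v = d * exp (2 * π * I * θ)`, multiplied by `d ^ (E * m)` in order to be an algebraic integer. -/
noncomputable def scaledValue (θ v : 𝓞 K) (d E n m k l : ℕ) : 𝓞 K :=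
  (n + m * θ) ^ k * (v ^ l * d ^ (E - l)) ^ m

theorem house_scaledValue_le [NumberField K] {θ v : 𝓞 K} {d : ℕ} {C : ℝ} (hC1 : 1 ≤ C)
    (hCθ : 1 + house (θ : K) ≤ C) (hCv : house (v : K) ≤ C) (hCd : d ≤ C)
    {D E n m k l s : ℕ} (hs : 1 ≤ s) (hn : n ≤ s) (hm : m ≤ s) (hk : k ≤ D) (hl : l ≤ E) :
    house (scaledValue θ v d E n m k l : K) ≤ (C * s) ^ (D + E * s) := by
  have hs' : (1 : ℝ) ≤ s := by exact_mod_cast hs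
  have hCs : C ≤ C * s := le_mul_of_one_le_right (by linarith) hs'
  have hpoint : house (n + m * θ : K) ≤ C * s := by
    have hn' : (n : ℝ) ≤ s := by exact_mod_cast hn
    have hm' : (m : ℝ) ≤ s := by exact_mod_cast hm
    have h₁ := house_add_le (n : K) (m * θ)
    have h₂ := house_nat_mul (θ : K) m
    have h₃ : house (n : K) = n := by simpa using house_intCast (K := K) n
    have h₄ := house_nonneg (θ : K)
    nlinarith [mul_le_mul_of_nonneg_right hm' h₄]
  have hd : house (d : K) ≤ C := by
    have : house (d : K) = d := by simpa using house_intCast (K := K) d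
    rwa [this]
  have hbase : house ((v : K) ^ l * (d : K) ^ (E - l)) ≤ C ^ E := by
    calc house ((v : K) ^ l * (d : K) ^ (E - l))
        ≤ house (v : K) ^ l * house (d : K) ^ (E - l) :=
          (house_mul_le _ _).trans (mul_le_mul (house_pow_le _ _) (house_pow_le _ _)
            (house_nonneg _) (pow_nonneg (house_nonneg _) _))
      _ ≤ C ^ l * C ^ (E - l) := by 
          have := house_nonneg (v : K)
          have := house_nonneg (d : K)
          gcongr
      _ = C ^ E := by rw [← pow_add, Nat.add_sub_cancel' hl]
  have hval : (scaledValue θ v d E n m k l : K) =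
      (n + m * θ : K) ^ k * ((v : K) ^ l * (d : K) ^ (E - l)) ^ m := by
    simp [scaledValue]
  rw [hval, pow_add]
  refine (house_mul_le _ _).trans (mul_le_mul ?_ ?_ (house_nonneg _) (by positivity))
  · calc _ ≤ house (n + m * θ : K) ^ k := house_pow_le _ _
      _ ≤ (C * s) ^ k := pow_le_pow_left₀ (house_nonneg _) hpoint k
      _ ≤ (C * s) ^ D := pow_le_pow_right₀ (by linarith) hk
  · calc _ ≤ house ((v : K) ^ l * (d : K) ^ (E - l)) ^ m := house_pow_le _ _
      _ ≤ (C ^ E) ^ m := pow_le_pow_left₀ (house_nonneg _) hbase m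
      _ = C ^ (E * m) := by rw [pow_mul]
      _ ≤ C ^ (E * s) := pow_le_pow_right₀ hC1 (by gcongr)
      _ ≤ (C * s) ^ (E * s) := by gcongr

/-- The auxiliary function with coefficients `c`. -/
noncomputable def expPoly {D E : ℕ} (c : Fin D × Fin E → ℂ) (z : ℂ) : ℂ :=
  ∑ j, c j * (z ^ (j.1 : ℕ) * Complex.exp (2 * Real.pi * Complex.I * (j.2 * z)))

theorem differentiable_expPoly {D E : ℕ} (c : Fin D × Fin E → ℂ) :
    Differentiable ℂ (expPoly c) := by
  unfold expPoly
  fun_prop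

theorem norm_expPoly_le {D E : ℕ} {c : Fin D × Fin E → ℂ} {B R : ℝ} (hc : ∀ j, ‖c j‖ ≤ B)
    (hB : 0 ≤ B) (hR : 1 ≤ R) {z : ℂ} (hz : ‖z‖ ≤ R) :
    ‖expPoly c z‖ ≤ D * E * (B * (R ^ D * Real.exp (2 * Real.pi * (E * R)))) := by
  rw [show D * E * (B * (R ^ D * Real.exp (2 * Real.pi * (E * R)))) =
    ∑ _j : Fin D × Fin E, B * (R ^ D * Real.exp (2 * Real.pi * (E * R))) by simp]
  refine (norm_sum_le _ _).trans (Finset.sum_le_sum fun j _ ↦ ?_)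
  rw [norm_mul, norm_mul, norm_pow]
  gcongr
  · exact hc j
  · exact (pow_le_pow_left₀ (norm_nonneg _) hz _).trans (pow_le_pow_right₀ hR j.1.2.le)
  · refine (Complex.norm_exp_le_exp_norm _).trans (Real.exp_le_exp.2 ?_)
    have hj : ((j.2 : ℕ) : ℝ) ≤ E := by exact_mod_cast j.2.2.le
    simp only [norm_mul, Complex.norm_I, Complex.norm_real, Complex.norm_natCast, mul_one,
      Complex.norm_ofNat, Real.norm_eq_abs, abs_of_pos Real.pi_pos]
    gcongr

theorem expPoly_natCast_add_natCast_mul {D E : ℕ} (c : Fin D × Fin E → ℂ) (θ : ℂ) (n m : ℕ) :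
    expPoly c (n + m * θ) = ∑ j, c j * ((n + m * θ) ^ (j.1 : ℕ) *
      Complex.exp (2 * Real.pi * Complex.I * θ) ^ (m * j.2)) := by
  refine Finset.sum_congr rfl fun j _ ↦ ?_
  rw [← Complex.exp_nat_mul]
  congr 2
  rw [Complex.exp_eq_exp_iff_exists_int]
  exact ⟨j.2 * n, by push_cast; ring⟩

theorem map_sum_mul_scaledValue {σ : K →+* ℂ} {θ v : 𝓞 K} {d : ℕ}
    (hv : σ v = d * Complex.exp (2 * Real.pi * Complex.I * σ θ)) {D E : ℕ}
    (c : Fin D × Fin E → 𝓞 K) (n m : ℕ) :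
    σ (∑ j, c j * scaledValue θ v d E n m j.1 j.2 : 𝓞 K) =
      d ^ (E * m) * expPoly (fun j ↦ σ (c j)) (n + m * σ θ) := by
  simp only [expPoly_natCast_add_natCast_mul, scaledValue, map_sum, map_mul, map_pow, map_add,
    map_natCast, hv, Finset.mul_sum]
  refine Finset.sum_congr rfl fun j _ ↦ ?_
  have hd : (d : ℂ) ^ (E * m) = (d ^ (j.2 : ℕ) * d ^ (E - j.2)) ^ m := by
    rw [← pow_add, Nat.add_sub_cancel' j.2.2.le, pow_mul]
  rw [hd]
  ring

theorem injective_natCast_add_mul {θ : ℂ} (hθ : ∀ a b : ℤ, b * θ = a → b = 0) :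
    Function.Injective fun p : ℕ × ℕ ↦ (p.1 + p.2 * θ : ℂ) := by
  rintro ⟨n, m⟩ ⟨n', m'⟩ h
  have hm := hθ (n' - n) (m - m') (by push_cast; linear_combination h)
  obtain rfl : m = m' := by lia
  simpa using h

/-- If the auxiliary function vanishes at all `n + m * θ` with `n, m < s`, then it vanishes at
those with `n, m ≤ s`. -/
theorem sum_mul_scaledValue_eq_zero [NumberField K] {σ : K →+* ℂ} {θ v : 𝓞 K} {d : ℕ}
    (hv : σ v = d * Complex.exp (2 * Real.pi * Complex.I * σ θ))
    (hθ : ∀ a b : ℤ, b * σ θ = a → b = 0) {C : ℝ} (hC1 : 1 ≤ C)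
    (hCθ : 5 * (1 + house (θ : K)) ≤ C) (hCv : house (v : K) ≤ C) (hCd : d ≤ C)
    (hCe : d * Real.exp (2 * Real.pi * (5 * (1 + house (θ : K)))) ≤ C)
    {D E s : ℕ} (hs : 1 ≤ s) {c : Fin D × Fin E → 𝓞 K} {B : ℝ} (hB : 0 ≤ B)
    (hc : ∀ j, house (c j : K) ≤ B)
    (hlt : (D * E * (B * (C * s) ^ (D + E * s))) ^ finrank ℚ K < 2 ^ (s * s))
    (hzero : ∀ n < s, ∀ m < s, ∑ j, c j * scaledValue θ v d E n m j.1 j.2 = 0)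
    (hd : d ≠ 0)
    {n m : ℕ} (hn : n ≤ s) (hm : m ≤ s) : ∑ j, c j * scaledValue θ v d E n m j.1 j.2 = 0 := by
  by_contra hne
  have hs' : (1 : ℝ) ≤ s := by exact_mod_cast hs
  have hH := house_nonneg (θ : K)
  have hσθ := norm_embedding_le_house (θ : K) σ
  set H := house (θ : K)
  set x : 𝓞 K := ∑ j, c j * scaledValue θ v d E n m j.1 j.2 with hx
  set W : ℝ := D * E * (B * (C * s) ^ (D + E * s)) with hW
  have hpoint : ∀ n m : ℕ, n ≤ s → m ≤ s → ‖(n + m * σ θ : ℂ)‖ ≤ s * (1 + H) := by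
    intro n m hn hm
    have hn' : (n : ℝ) ≤ s := by exact_mod_cast hn
    have hm' : (m : ℝ) ≤ s := by exact_mod_cast hm
    calc ‖(n + m * σ θ : ℂ)‖ ≤ ‖(n : ℂ)‖ + ‖(m * σ θ : ℂ)‖ := norm_add_le _ _
      _ = n + m * ‖σ θ‖ := by simp
      _ ≤ s + s * H := by gcongr
      _ = s * (1 + H) := by ring
  have hhouse : house (x : K) ≤ W := by
    have hsum : (x : K) = ∑ j, (c j : K) * scaledValue θ v d E n m j.1 j.2 := by
      simp [hx]
    rw [hsum, show W = ∑ _j : Fin D × Fin E, B * (C * s) ^ (D + E * s) by simp [hW]]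
    refine (house_sum_le_sum_house _ _).trans (Finset.sum_le_sum fun j _ ↦ ?_)
    refine (house_mul_le _ _).trans (mul_le_mul (hc j) ?_ (house_nonneg _) hB)
    exact house_scaledValue_le hC1 (by linarith) hCv hCd hs hn hm j.1.2.le j.2.2.le
  have hsmall : ‖σ x‖ ≤ W / 2 ^ (s * s) := by
    have hinj := injective_natCast_add_mul hθ
    set Z : Finset ℂ := (Finset.range s ×ˢ Finset.range s).map ⟨_, hinj⟩ with hZ
    have hZcard : Z.card = s * s := by simp [hZ]
    have hf := norm_le_div_two_pow_card_of_forall_eq_zero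
      (differentiable_expPoly fun j ↦ σ (c j)) (Z := Z) (r := s * (1 + H)) (z := n + m * σ θ)
      (M := D * E * (B * ((5 * (s * (1 + H))) ^ D *
        Real.exp (2 * Real.pi * (E * (5 * (s * (1 + H)))))))) ?_ (by positivity) ?_ ?_
        (hpoint n m hn hm)
    · rw [hx, map_sum_mul_scaledValue hv, norm_mul, norm_pow, Complex.norm_natCast]
      refine (mul_le_mul_of_nonneg_left hf (by positivity)).trans ?_
      rw [hZcard, ← mul_div_assoc, hW]
      refine div_le_div_of_nonneg_right ?_ (by positivity)
      have he : (d : ℝ) ^ (E * m) * Real.exp (2 * Real.pi * (E * (5 * (s * (1 + H))))) ≤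
          (C * s) ^ (E * s) := by
        have hd1 : (1 : ℝ) ≤ d := by exact_mod_cast Nat.one_le_iff_ne_zero.2 hd
        calc (d : ℝ) ^ (E * m) * Real.exp (2 * Real.pi * (E * (5 * (s * (1 + H)))))
            = (d : ℝ) ^ (E * m) * Real.exp (2 * Real.pi * (5 * (1 + H))) ^ (E * s) := by
              rw [← Real.exp_nat_mul]; push_cast; ring_nf
          _ ≤ (d : ℝ) ^ (E * s) * Real.exp (2 * Real.pi * (5 * (1 + H))) ^ (E * s) := by
              gcongr
          _ ≤ C ^ (E * s) := by rw [← mul_pow]; gcongr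
          _ ≤ (C * s) ^ (E * s) := by
              gcongr; exact le_mul_of_one_le_right (by linarith) hs'
      have hp : (5 * (s * (1 + H))) ^ D ≤ (C * s) ^ D := by
        refine pow_le_pow_left₀ (by positivity) ?_ D
        nlinarith
      calc (d : ℝ) ^ (E * m) * (D * E * (B * ((5 * (s * (1 + H))) ^ D *
            Real.exp (2 * Real.pi * (E * (5 * (s * (1 + H))))))))
          = D * E * (B * ((5 * (s * (1 + H))) ^ D * ((d : ℝ) ^ (E * m) *
            Real.exp (2 * Real.pi * (E * (5 * (s * (1 + H)))))))) := by ring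
        _ ≤ D * E * (B * ((C * s) ^ D * (C * s) ^ (E * s))) := by gcongr
        _ = D * E * (B * (C * s) ^ (D + E * s)) := by rw [pow_add]
    · intro ζ hζ
      simp only [hZ, Finset.mem_map, Finset.mem_product, Finset.mem_range,
        Function.Embedding.coeFn_mk] at hζ
      obtain ⟨⟨n', m'⟩, ⟨hn', hm'⟩, rfl⟩ := hζ
      have h := map_sum_mul_scaledValue hv c n' m'
      rw [hzero n' hn' m' hm'] at h
      simpa [hd] using h.symm
    · intro ζ hζ
      simp only [hZ, Finset.mem_map, Finset.mem_product, Finset.mem_range,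
        Function.Embedding.coeFn_mk] at hζ
      obtain ⟨⟨n', m'⟩, ⟨hn', hm'⟩, rfl⟩ := hζ
      exact hpoint n' m' hn'.le hm'.le
    · intro z hz
      refine norm_expPoly_le (fun j ↦ (norm_embedding_le_house _ σ).trans (hc j)) hB ?_ hz
      nlinarith
  have hW0 : 0 ≤ W := (house_nonneg _).trans hhouse
  have h1 := one_le_norm_mul_house_pow σ hne
  have h2 : ‖σ x‖ * house (x : K) ^ (finrank ℚ K - 1) ≤
      W / 2 ^ (s * s) * W ^ (finrank ℚ K - 1) := by
    have := house_nonneg (x : K)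
    gcongr
  have h3 : W / 2 ^ (s * s) * W ^ (finrank ℚ K - 1) = W ^ finrank ℚ K / 2 ^ (s * s) := by
    rw [div_mul_eq_mul_div, mul_comm, ← pow_succ, Nat.sub_add_cancel finrank_pos]
  have h4 := (h1.trans h2).trans_eq h3
  rw [one_le_div (by positivity)] at h4
  exact h4.not_gt hlt

end

theorem eventually_mul_pow_lt_two_pow {C : ℝ} (hC : 2 ≤ C) (A : ℕ) :
    ∀ᶠ s : ℕ in Filter.atTop, ∀ T : ℕ, T ^ 2 ≤ s → (C * s) ^ (A * T * s) < (2 : ℝ) ^ (s * s) := by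
  have hlog : Filter.Tendsto (fun x : ℝ ↦ A * (Real.log C * x ^ (-(1 / 2) : ℝ) +
      Real.log x / x ^ (1 / 2 : ℝ))) Filter.atTop (nhds (A * (Real.log C * 0 + 0))) :=
    (((tendsto_rpow_neg_atTop (by norm_num)).const_mul _).add
      (isLittleO_log_rpow_atTop (by norm_num)).tendsto_div_nhds_zero).const_mul _
  have hlt := hlog.comp tendsto_natCast_atTop_atTop
    |>.eventually_lt_const (u := Real.log 2) (by simpa using Real.log_pos one_lt_two)
  filter_upwards [hlt, Filter.eventually_ge_atTop 1] with s hs hs1 T hT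
  have hs0 : (0 : ℝ) < s := by exact_mod_cast hs1
  have hsq : Real.sqrt s * Real.sqrt s = s := Real.mul_self_sqrt hs0.le
  have hsq0 : 0 < Real.sqrt s := Real.sqrt_pos.2 hs0
  have hTs : (T : ℝ) ≤ Real.sqrt s := Real.le_sqrt_of_sq_le (by exact_mod_cast hT)
  have hs1' : (1 : ℝ) ≤ s := by exact_mod_cast hs1
  have hCs : 0 ≤ Real.log C + Real.log s :=
    add_nonneg (Real.log_nonneg (by linarith)) (Real.log_nonneg hs1')
  simp only [Function.comp_apply, Real.rpow_neg hs0.le, ← Real.sqrt_eq_rpow] at hs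
  have hs' : A * (Real.log C + Real.log s) < Real.log 2 * Real.sqrt s := by
    rw [← div_lt_iff₀ hsq0]
    convert hs using 1
    ring
  rw [← Real.log_lt_log_iff (by positivity) (by positivity), Real.log_pow, Real.log_pow,
    Real.log_mul (by positivity) hs0.ne']
  push_cast
  calc (A * T * s * (Real.log C + Real.log s) : ℝ)
      ≤ A * Real.sqrt s * s * (Real.log C + Real.log s) := by gcongr
    _ = A * (Real.log C + Real.log s) * (Real.sqrt s * s) := by ring
    _ < Real.log 2 * Real.sqrt s * (Real.sqrt s * s) := by gcongr
    _ = s * s * Real.log 2 := by linear_combination Real.log 2 * s * hsq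

/-- The size of the auxiliary function and its values, for `2 * T ^ 3` powers of `z` and `T`
exponentials, the coefficients being bounded by Siegel's lemma. -/
theorem pow_le_of_siegel_bound {C : ℝ} (hC : 2 ≤ C) {T D s : ℕ} (hT : 1 ≤ T) (hD : D = 2 * T ^ 3)
    (hs : T ^ 2 ≤ s) (h : ℕ) :
    (D * T * (C * (C * (2 * T ^ 4) * (C * (T ^ 2 : ℕ)) ^ (D + T * T ^ 2)) *
      (C * s) ^ (D + T * s)) : ℝ) ^ h ≤ (C * s) ^ (12 * h * T * s) := by
  have hSs : ((T ^ 2 : ℕ) : ℝ) ≤ s := by exact_mod_cast hs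
  have hS1 : 1 ≤ T ^ 2 := Nat.one_le_pow _ _ hT
  have hs1 : (1 : ℝ) ≤ s := by exact_mod_cast hS1.trans hs
  have hTs1 : 1 ≤ T * s := Nat.mul_pos hT (hS1.trans hs)
  have hDs : D ≤ 2 * (T * s) := by rw [hD]; nlinarith
  have hTT : T * T ^ 2 ≤ T * s := Nat.mul_le_mul_left T hs
  have hT4 : (2 * T ^ 4 : ℝ) ≤ (C * s) ^ 2 := by
    have h₁ : (T ^ 4 : ℝ) ≤ (s : ℝ) ^ 2 := by
      calc (T ^ 4 : ℝ) = ((T ^ 2 : ℕ) : ℝ) ^ 2 := by push_cast; ring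
        _ ≤ (s : ℝ) ^ 2 := by gcongr
    rw [mul_pow]
    have h₂ : 2 ≤ C ^ 2 := by nlinarith
    gcongr
  have hDT : (D * T : ℝ) ≤ (C * s) ^ 2 := by
    refine le_trans (le_of_eq ?_) hT4
    rw [hD]; push_cast; ring
  have hpow : (C * (T ^ 2 : ℕ)) ^ (D + T * T ^ 2) ≤ (C * s) ^ (D + T * T ^ 2) := by gcongr
  have hCY : C ≤ C * s := le_mul_of_one_le_right (by linarith) hs1
  generalize C * s = Y at *
  have hY1 : 1 ≤ Y := by linarith
  have hpow' : (C * (T ^ 2 : ℕ)) ^ (D + T * T ^ 2) ≤ Y ^ (3 * (T * s)) :=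
    hpow.trans (pow_le_pow_right₀ hY1 (by lia))
  have hpow'' : Y ^ (D + T * s) ≤ Y ^ (3 * (T * s)) := pow_le_pow_right₀ hY1 (by lia)
  calc _ ≤ (Y ^ 2 * (Y * (Y * Y ^ 2 * Y ^ (3 * (T * s))) * Y ^ (3 * (T * s)))) ^ h := by gcongr
    _ = Y ^ ((6 + 6 * (T * s)) * h) := by ring
    _ ≤ Y ^ (12 * (T * s) * h) := pow_le_pow_right₀ hY1 (Nat.mul_le_mul_right _ (by lia))
    _ = Y ^ (12 * h * T * s) := by ring_nf

theorem injective_exp_pow {θ : ℂ} (hθ : ∀ a b : ℤ, b * θ = a → b = 0) :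
    Function.Injective fun m : ℕ ↦ Complex.exp (2 * Real.pi * Complex.I * θ) ^ m := by
  intro m m' h
  simp only [← Complex.exp_nat_mul] at h
  obtain ⟨k, hk⟩ := Complex.exp_eq_exp_iff_exists_int.1 h
  have := hθ k (m - m') (mul_left_cancel₀ Complex.two_pi_I_ne_zero
    (by push_cast; linear_combination hk))
  lia

theorem false_of_map_eq_mul_exp {K : Type*} [Field K] [NumberField K] {σ : K →+* ℂ} {θ v : 𝓞 K}
    {d : ℕ} (hd : d ≠ 0) (hv : σ v = d * Complex.exp (2 * Real.pi * Complex.I * σ θ))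
    (hθ : ∀ a b : ℤ, b * σ θ = a → b = 0) : False := by
  obtain ⟨C₀, hC₀⟩ := exists_siegel_const K
  set H := house (θ : K)
  have hH : 0 ≤ H := house_nonneg _
  have hHv := house_nonneg (v : K)
  set e := d * Real.exp (2 * Real.pi * (5 * (1 + H)))
  have he : 0 ≤ e := by positivity
  have hd0 : (0 : ℝ) ≤ d := by positivity
  have habs := abs_nonneg C₀
  set C : ℝ := |C₀| + 5 * (1 + H) + house (v : K) + d + e with hC
  obtain ⟨s₀, hs₀⟩ := Filter.eventually_atTop.1
    (eventually_mul_pow_lt_two_pow (show 2 ≤ C by linarith) (12 * finrank ℚ K))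
  obtain ⟨T, hT⟩ : ∃ T, T = s₀ + 1 := ⟨_, rfl⟩
  have hT1 : 1 ≤ T := by lia
  have hS1 : 1 ≤ T ^ 2 := Nat.one_le_pow _ _ hT1
  have hSs₀ : s₀ ≤ T ^ 2 := by nlinarith
  obtain ⟨D, hD⟩ : ∃ D, D = 2 * T ^ 3 := ⟨_, rfl⟩
  let a : Matrix (Fin (T ^ 2) × Fin (T ^ 2)) (Fin D × Fin T) (𝓞 K) :=
    fun p j ↦ scaledValue θ v d T p.1 p.2 j.1 j.2
  have ha : a ≠ 0 := by
    intro h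
    have := congrFun₂ h (⟨0, hS1⟩, ⟨0, hS1⟩) (⟨0, by rw [hD]; positivity⟩, ⟨0, hT1⟩)
    simp [a, scaledValue] at this
  obtain ⟨c, hc0, hac, hcB⟩ := hC₀ a ((C * (T ^ 2 : ℕ)) ^ (D + T * T ^ 2)) ha (by simp; positivity)
    (by simp [hD]; ring) fun p j ↦ house_scaledValue_le (by linarith) (by linarith) (by linarith)
      (by linarith) hS1 p.1.2.le p.2.2.le j.1.2.le j.2.2.le
  set B : ℝ := C * (C * (2 * T ^ 4) * (C * (T ^ 2 : ℕ)) ^ (D + T * T ^ 2)) with hB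
  have hC2 : 2 ≤ C := by linarith
  have hcB' : ∀ j, house (c j : K) ≤ B := by
    intro j
    refine (hcB j).trans ?_
    have hcard : (Fintype.card (Fin D × Fin T) : ℝ) = 2 * T ^ 4 := by
      simp [hD]; ring
    rw [hcard, hB]
    have h₁ : C₀ * C₀ ≤ C * C := by
      rw [← abs_mul_abs_self]
      have : |C₀| ≤ C := by linarith
      gcongr
    calc C₀ * (C₀ * (2 * T ^ 4) * (C * (T ^ 2 : ℕ)) ^ (D + T * T ^ 2))
        = C₀ * C₀ * ((2 * T ^ 4) * (C * (T ^ 2 : ℕ)) ^ (D + T * T ^ 2)) := by ring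
      _ ≤ C * C * ((2 * T ^ 4) * (C * (T ^ 2 : ℕ)) ^ (D + T * T ^ 2)) := by gcongr
      _ = _ := by ring
  have hlt : ∀ s, T ^ 2 ≤ s → (D * T * (B * (C * s) ^ (D + T * s)) : ℝ) ^ finrank ℚ K <
      2 ^ (s * s) := by
    intro s hs
    exact (pow_le_of_siegel_bound hC2 hT1 hD hs _).trans_lt (hs₀ s (hSs₀.trans hs) T hs)
  have hzero : ∀ s, T ^ 2 ≤ s → ∀ n < s, ∀ m < s, ∑ j, c j * scaledValue θ v d T n m j.1 j.2 = 0 := by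
    intro s hs
    induction s, hs using Nat.le_induction with
    | base =>
      intro n hn m hm
      simpa [Matrix.mulVec, dotProduct, a, mul_comm] using congrFun hac (⟨n, hn⟩, ⟨m, hm⟩)
    | succ s hs ih =>
      intro n hn m hm
      exact sum_mul_scaledValue_eq_zero hv hθ (by linarith) (by linarith) (by linarith)
        (by linarith) (by linarith) (hS1.trans hs) (by positivity) hcB' (hlt s hs) ih hd
        (by lia) (by lia)
  have hcσ : (fun j ↦ σ (c j)) = 0 := by
    refine eq_zero_of_forall_sum_mul_pow_eq_zero (injective_exp_pow hθ) (θ := σ θ) fun n m ↦ ?_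
    rw [← expPoly_natCast_add_natCast_mul]
    have h := map_sum_mul_scaledValue hv c n m
    rw [hzero (T ^ 2 + n + m + 1) (by lia) n (by lia) m (by lia)] at h
    simpa [hd] using h.symm
  exact hc0 (funext fun j ↦ by simpa using congrFun hcσ j)

theorem IsAlgebraic.exists_natCast_mul_isIntegral {z : ℂ} (hz : IsAlgebraic ℚ z) :
    ∃ d : ℕ, d ≠ 0 ∧ IsIntegral ℤ (d * z) := by
  obtain ⟨y, hy, hyz⟩ :=
    ((IsFractionRing.isAlgebraic_iff ℤ ℚ ℂ).2 hz).exists_integral_multiple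
  refine ⟨y.natAbs, Int.natAbs_ne_zero.2 hy, ?_⟩
  rw [zsmul_eq_mul] at hyz
  obtain h | h := Int.natAbs_eq y
  · rw [h] at hyz
    simpa using hyz
  · rw [h] at hyz
    simpa using hyz.neg

/-- The case of the Gelfond-Schneider theorem in which the logarithm is `2 * π * I`. -/
theorem transcendental_exp_two_pi_I_mul {t : ℂ} (ht : IsAlgebraic ℚ t)
    (hirr : ∀ a b : ℤ, b * t = a → b = 0) :
    Transcendental ℚ (Complex.exp (2 * Real.pi * Complex.I * t)) := by
  intro hexp
  obtain ⟨d₁, hd₁, ht₁⟩ := ht.exists_natCast_mul_isIntegral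
  obtain ⟨d, hd, hv⟩ := (hexp.pow d₁).exists_natCast_mul_isIntegral
  set v : ℂ := d * Complex.exp (2 * Real.pi * Complex.I * t) ^ d₁ with hv_def
  let K := IntermediateField.adjoin ℚ {(d₁ * t : ℂ), v}
  have hK : FiniteDimensional ℚ K := IntermediateField.finiteDimensional_adjoin <| by
    rintro x (rfl | rfl)
    · exact ht₁.tower_top
    · exact hv.tower_top
  have : NumberField K := ⟨⟩
  let θK : K := ⟨d₁ * t, IntermediateField.subset_adjoin _ _ (by simp)⟩
  let vK : K := ⟨v, IntermediateField.subset_adjoin _ _ (by simp)⟩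
  have hθ' : IsIntegral ℤ θK :=
    (isIntegral_algebraMap_iff (algebraMap K ℂ).injective).1 ht₁
  have hv' : IsIntegral ℤ vK :=
    (isIntegral_algebraMap_iff (algebraMap K ℂ).injective).1 hv
  refine false_of_map_eq_mul_exp (σ := algebraMap K ℂ) (θ := ⟨θK, hθ'⟩) (v := ⟨vK, hv'⟩) hd ?_ ?_
  · change v = d * Complex.exp (2 * Real.pi * Complex.I * (d₁ * t))
    rw [hv_def, ← Complex.exp_nat_mul]
    ring_nf
  · intro a b h
    change b * (d₁ * t) = a at h
    have := hirr a (b * d₁) (by push_cast; linear_combination h)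
    simpa [hd₁] using this

/-- If `α` is real and `β = e^{iα}` is algebraic over `ℚ`, then `α/π` is either
rational or transcendental over `ℚ`. -/
theorem stmt_4 (α : ℝ) (halg : IsAlgebraic ℚ (Complex.exp (Complex.I * α))) :
    (∃ r : ℚ, α / Real.pi = (r : ℝ)) ∨ Transcendental ℚ (α / Real.pi) := by
  by_contra! h
  obtain ⟨hrat, htr⟩ := h
  have ht : IsAlgebraic ℚ (α / Real.pi) := not_not.1 htr
  refine transcendental_exp_two_pi_I_mul (t := (α / Real.pi : ℝ)) (ht.algebraMap (A := ℂ)) ?_ ?_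
  · intro a b hab
    by_contra hb
    refine hrat (a / b) ?_
    have hab' : b * (α / Real.pi) = a := by exact_mod_cast hab
    have hb' : (b : ℝ) ≠ 0 := by exact_mod_cast hb
    push_cast
    rw [eq_div_iff hb', mul_comm, hab']
  · have hexp : Complex.exp (2 * Real.pi * Complex.I * (α / Real.pi : ℝ)) =
        Complex.exp (Complex.I * α) ^ 2 := by
      rw [← Complex.exp_nat_mul]
      congr 1
      push_cast
      have : (Real.pi : ℂ) ≠ 0 := by exact_mod_cast Real.pi_ne_zero
      field_simp
    rw [hexp]
    exact halg.pow 2
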